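/- arXiv:2309.05149 — 2 statements merged into one kernel-verified Lean document; each statement's English description precedes it below -/
import Mathlib

section
/- Let p ∈ (0, 1/4] be a real number, let n ≥ 9 and m ≥ 1 be integers with m ≤ n, and let t be an integer with t ≥ 1 and |t − log_p(m/n)| ≤ 1/2. Then for every subset f of [n] with |f| = t − 1, the probability under G(n,p) that f is NOT a face of N_m(G) (i.e., that f has fewer than m common neighbors) is at most exp(−m²/(3n)). Equivalently, if B is a binomial random variable with n − (t − 1) trials and success probability p^{t−1}, then P(B < m) ≤ exp(−m²/(3n)). -/
open MeasureTheory

/-- Configuration of edge indicators for a graph on vertex set `Fin n`. -/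
abbrev EdgeCfg (n : ℕ) := {e : Sym2 (Fin n) // ¬ e.IsDiag} → Bool

/-- Bernoulli measure on `Bool` with success probability `p`. -/
noncomputable def bern (p : ℝ) : Measure Bool :=
  ENNReal.ofReal p • Measure.dirac true + ENNReal.ofReal (1 - p) • Measure.dirac false

/-- The Erdős–Rényi measure `G(n,p)`: edge indicators are i.i.d. Bernoulli(p). -/
noncomputable def erdosRenyi (n : ℕ) (p : ℝ) : Measure (EdgeCfg n) :=
  Measure.pi fun _ => bern p

/-- `u` and `v` are adjacent in the graph encoded by `ω`. -/
def Adj {n : ℕ} (ω : EdgeCfg n) (u v : Fin n) : Prop :=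
  ∃ h : u ≠ v, ω ⟨s(u, v), by simpa [Sym2.mk_isDiag_iff] using h⟩ = true

open Classical in
/-- The set of common neighbors of `S`. -/
noncomputable def commonNbrs {n : ℕ} (ω : EdgeCfg n) (S : Finset (Fin n)) : Finset (Fin n) :=
  Finset.univ.filter fun v => v ∉ S ∧ ∀ u ∈ S, Adj ω v u

/-- `S` is a face of the `m`-neighbor complex of the graph encoded by `ω`. -/
def IsFace {n : ℕ} (ω : EdgeCfg n) (m : ℕ) (S : Finset (Fin n)) : Prop :=
  m ≤ (commonNbrs ω S).card

open ProbabilityTheory in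
/-- Lower-tail Hoeffding bound for the number of events that occur among independent events of
common probability `q`. -/
theorem iIndepSet_sum_indicator_lt_le {Ω ι : Type*} [MeasurableSpace Ω] [Fintype ι]
    {μ : Measure Ω} [IsProbabilityMeasure μ] {E : ι → Set Ω} (hE : ∀ i, MeasurableSet (E i))
    (hind : iIndepSet E μ) {q m : ℝ} (hq : ∀ i, μ.real (E i) = q)
    (hm : m ≤ Fintype.card ι * q) :
    μ.real {ω | ∑ i, (E i).indicator (fun _ => (1 : ℝ)) ω < m} ≤
      Real.exp (-(2 * (Fintype.card ι * q - m) ^ 2) / Fintype.card ι) := by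
  set X : ι → Ω → ℝ := fun i => (E i).indicator (fun _ => 1) with hX
  have hmeas : ∀ i, Measurable (X i) := fun i => measurable_const.indicator (hE i)
  have hint : ∀ i, μ[X i] = q := fun i => by
    rw [← hq i, hX]
    exact integral_indicator_one (hE i)
  have hsub : ∀ i ∈ Finset.univ,
      HasSubgaussianMGF (fun ω => q - X i ω) ((‖(1 : ℝ) - 0‖₊ / 2) ^ 2) μ := fun i _ => by
    have h := (hasSubgaussianMGF_of_mem_Icc (μ := μ) (a := 0) (b := 1) (hmeas i).aemeasurable
      (Filter.Eventually.of_forall fun ω => by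
        by_cases hω : ω ∈ E i <;> simp [hX, hω])).neg
    rw [hint i] at h
    convert h using 1
    ext ω
    simp
  have hindX : iIndepFun X μ := hind.iIndepFun_indicator
  have hindY : iIndepFun (fun i ω => q - X i ω) μ :=
    hindX.comp (fun _ x => q - x) fun _ => measurable_const.sub measurable_id
  have h := HasSubgaussianMGF.measure_sum_ge_le_of_iIndepFun hindY hsub (sub_nonneg.2 hm)
  refine (measureReal_mono (fun ω hω => ?_)).trans (h.trans_eq ?_)
  · simp only [Set.mem_ofPred_eq, Finset.sum_sub_distrib, Finset.sum_const, Finset.card_univ,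
      nsmul_eq_mul] at hω ⊢
    linarith
  · congr 1
    by_cases h0 : (Fintype.card ι : ℝ) = 0
    · simp [h0]
    · simp
      field_simp

theorem isProbabilityMeasure_bern {p : ℝ} (hp : p ∈ Set.Icc (0 : ℝ) 1) :
    IsProbabilityMeasure (bern p) where
  measure_univ := by
    simp [bern, ← ENNReal.ofReal_add hp.1 (sub_nonneg.2 hp.2)]

/-- The probability that all edges of a given set are present. -/
theorem erdosRenyi_forall_mem (n : ℕ) {p : ℝ} (hp : p ∈ Set.Icc (0 : ℝ) 1)
    (A : Finset {e : Sym2 (Fin n) // ¬ e.IsDiag}) :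
    erdosRenyi n p {ω | ∀ e ∈ A, ω e = true} = ENNReal.ofReal p ^ A.card := by
  classical
  have : IsProbabilityMeasure (bern p) := isProbabilityMeasure_bern hp
  have h : {ω : EdgeCfg n | ∀ e ∈ A, ω e = true} =
      Set.univ.pi fun e => if e ∈ A then {true} else Set.univ := by
    ext ω
    simp only [Set.mem_ofPred_eq, Set.mem_pi, Set.mem_univ, true_imp_iff]
    refine forall_congr' fun e => ?_
    split_ifs with he <;> simp [he]
  rw [h, erdosRenyi, Measure.pi_pi]
  have h1 : ∀ e, bern p (if e ∈ A then {true} else Set.univ) =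
      if e ∈ A then ENNReal.ofReal p else 1 := fun e => by
    split_ifs
    · simp [bern]
    · exact measure_univ
  rw [Finset.prod_congr rfl fun e _ => h1 e, Finset.prod_ite_mem, Finset.univ_inter,
    Finset.prod_const]

open ProbabilityTheory in
/-- Edge events supported on pairwise disjoint edge sets are independent. -/
theorem erdosRenyi_iIndepSet (n : ℕ) {p : ℝ} (hp : p ∈ Set.Icc (0 : ℝ) 1) {ι : Type*}
    {A : ι → Finset {e : Sym2 (Fin n) // ¬ e.IsDiag}}
    (hA : Pairwise fun i j => Disjoint (A i) (A j)) :
    iIndepSet (fun i => {ω : EdgeCfg n | ∀ e ∈ A i, ω e = true}) (erdosRenyi n p) := by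
  classical
  rw [iIndepSet_iff_meas_biInter fun i => Set.Finite.measurableSet (Set.toFinite _)]
  intro s
  have h : (⋂ i ∈ s, {ω : EdgeCfg n | ∀ e ∈ A i, ω e = true}) =
      {ω | ∀ e ∈ s.biUnion A, ω e = true} := by
    ext ω
    simp only [Set.mem_iInter, Set.mem_ofPred_eq, Finset.mem_biUnion]
    grind
  rw [h, erdosRenyi_forall_mem n hp, Finset.card_biUnion fun i _ j _ hij => hA hij,
    ← Finset.prod_pow_eq_pow_sum]
  simp only [erdosRenyi_forall_mem n hp]

/-- The edges joining a vertex `v` outside `f` to the vertices of `f`. -/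
def edgesTo {n : ℕ} (f : Finset (Fin n)) (v : {v // v ∉ f}) :
    Finset {e : Sym2 (Fin n) // ¬ e.IsDiag} :=
  f.attach.image fun u => ⟨s(v.1, u.1), by
    rw [Sym2.mk_isDiag_iff]
    exact fun h => v.2 (h ▸ u.2)⟩

theorem card_edgesTo {n : ℕ} (f : Finset (Fin n)) (v : {v // v ∉ f}) :
    (edgesTo f v).card = f.card := by
  rw [edgesTo, Finset.card_image_of_injective, Finset.card_attach]
  intro u w h
  exact Subtype.ext (Sym2.congr_right.1 (Subtype.mk.inj h))

theorem pairwise_disjoint_edgesTo {n : ℕ} (f : Finset (Fin n)) :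
    Pairwise fun v w => Disjoint (edgesTo f v) (edgesTo f w) := by
  intro v w hvw
  rw [Finset.disjoint_left]
  intro e hv hw
  obtain ⟨u, -, rfl⟩ := Finset.mem_image.1 hv
  obtain ⟨u', -, h⟩ := Finset.mem_image.1 hw
  rw [Subtype.mk.injEq, Sym2.eq_iff] at h
  rcases h with ⟨h, -⟩ | ⟨h, -⟩
  · exact hvw (Subtype.ext h.symm)
  · exact w.2 (h ▸ u.2)

theorem forall_mem_edgesTo_iff {n : ℕ} (ω : EdgeCfg n) (f : Finset (Fin n)) (v : {v // v ∉ f}) :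
    (∀ e ∈ edgesTo f v, ω e = true) ↔ ∀ u ∈ f, Adj ω v u := by
  rw [edgesTo, Finset.forall_mem_image]
  exact ⟨fun h u hu => ⟨fun h' => v.2 (h' ▸ hu), h (Finset.mem_attach f ⟨u, hu⟩)⟩,
    fun h u _ => (h u.1 u.2).2⟩

theorem card_commonNbrs_eq_sum {n : ℕ} (ω : EdgeCfg n) (f : Finset (Fin n)) :
    ((commonNbrs ω f).card : ℝ) = ∑ v : {v // v ∉ f},
      {ω : EdgeCfg n | ∀ e ∈ edgesTo f v, ω e = true}.indicator (fun _ => (1 : ℝ)) ω := by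
  classical
  simp only [Set.indicator_apply, Set.mem_ofPred_eq, forall_mem_edgesTo_iff]
  rw [Finset.sum_boole, commonNbrs]
  congr 1
  refine (Finset.card_bij (fun v _ => v.1) ?_ ?_ ?_).symm
  · simp +contextual
  · exact fun v _ w _ h => Subtype.ext h
  · intro v hv
    simp only [Finset.mem_filter, Finset.mem_univ, true_and] at hv
    exact ⟨⟨v, hv.1⟩, by simpa using hv.2, rfl⟩

/-- A set `f` of vertices whose expected number of common neighbors is at least `m` fails to be a
face of the `m`-neighbor complex with exponentially small probability. -/
theorem erdosRenyi_not_isFace_le {n : ℕ} {p : ℝ} (hp : p ∈ Set.Icc (0 : ℝ) 1) (m : ℕ)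
    (f : Finset (Fin n)) (hm : m ≤ ((n : ℝ) - f.card) * p ^ f.card) :
    erdosRenyi n p {ω | ¬ IsFace ω m f} ≤ ENNReal.ofReal
      (Real.exp (-(2 * (((n : ℝ) - f.card) * p ^ f.card - m) ^ 2) / (n - f.card))) := by
  have : IsProbabilityMeasure (bern p) := isProbabilityMeasure_bern hp
  have : IsProbabilityMeasure (erdosRenyi n p) := by
    unfold erdosRenyi
    infer_instance
  have hcard : (Fintype.card {v // v ∉ f} : ℝ) = n - f.card := by
    have h := f.card_le_univ
    rw [Fintype.card_subtype_compl, Fintype.card_coe, Nat.cast_sub h, Fintype.card_fin]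
  rw [← hcard] at hm ⊢
  rw [← ofReal_measureReal]
  refine ENNReal.ofReal_le_ofReal ?_
  convert iIndepSet_sum_indicator_lt_le (fun v => Set.Finite.measurableSet (Set.toFinite _))
    (erdosRenyi_iIndepSet n hp (pairwise_disjoint_edgesTo f)) (fun v => ?_) hm using 3
  · ext ω
    rw [← card_commonNbrs_eq_sum, IsFace, not_le, Nat.cast_lt]
  · rw [measureReal_def, erdosRenyi_forall_mem n hp, card_edgesTo, ENNReal.toReal_pow,
      ENNReal.toReal_ofReal hp.1]

/-- If `k` is at most `log_p (m / n) - 1 / 2`, then `p ^ k` is at least `2 m / n`. -/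
theorem two_mul_le_mul_pow {p : ℝ} (hp0 : 0 < p) (hp1 : p ≤ 1 / 4) {n m k : ℕ} (hm : 0 < m)
    (hn : 0 < n) (hk : (k : ℝ) + 1 / 2 ≤ (Real.log m - Real.log n) / Real.log p) :
    2 * (m : ℝ) ≤ n * p ^ k := by
  have hm' : (0 : ℝ) < m := by exact_mod_cast hm
  have hn' : (0 : ℝ) < n := by exact_mod_cast hn
  have hlog : Real.log p ≤ -(2 * Real.log 2) := by
    refine (Real.log_le_log hp0 hp1).trans_eq ?_
    rw [show (1 / 4 : ℝ) = (2 ^ 2)⁻¹ by norm_num, Real.log_inv, Real.log_pow]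
    norm_num
  have h2 : 0 < Real.log 2 := Real.log_pos one_lt_two
  rw [le_div_iff_of_neg (by linarith)] at hk
  rw [← Real.log_le_log_iff (by positivity) (by positivity), Real.log_mul (by simp) hm'.ne',
    Real.log_mul hn'.ne' (by positivity), Real.log_pow]
  linarith

/-- Lemma 2 of the paper, case $p \le 1/4$: if $n \ge 9$, $t \ge 1$ and
$|t - \log_p(m/n)| \le 1/2$, then any set of $t-1$ vertices fails to be a face of
$N_m(G(n,p))$ with probability at most $\exp(-m^2/(3n))$. -/
theorem stmt2 (p : ℝ) (hp0 : 0 < p) (hp1 : p ≤ 1/4)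
    (n m t : ℕ) (hn : 9 ≤ n) (hm1 : 1 ≤ m) (hmn : m ≤ n) (ht1 : 1 ≤ t)
    (ht : |(t : ℝ) - (Real.log m - Real.log n) / Real.log p| ≤ 1/2)
    (f : Finset (Fin n)) (hf : f.card = t - 1) :
    erdosRenyi n p {ω | ¬ IsFace ω m f} ≤
      ENNReal.ofReal (Real.exp (-((m : ℝ)^2) / (3 * n))) := by
  obtain ⟨k, rfl⟩ := Nat.exists_eq_add_of_le' ht1
  rw [Nat.add_sub_cancel] at hf
  have hk : (k : ℝ) + 1 / 2 ≤ (Real.log m - Real.log n) / Real.log p := by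
    have h := (abs_le.1 ht).2
    push_cast at h
    linarith
  have hpow := two_mul_le_mul_pow hp0 hp1 (by omega) (by omega : 0 < n) hk
  have hn0 : (0 : ℝ) < n := by exact_mod_cast (by omega : 0 < n)
  have hm0 : (1 : ℝ) ≤ m := by exact_mod_cast hm1
  have hkn : 3 * (k : ℝ) ≤ n := by
    have h4 : p ^ k * (1 + k * 3) ≤ 1 :=
      calc p ^ k * (1 + k * 3) ≤ (1 / 4) ^ k * (1 + 3) ^ k := by
            gcongr
            exact one_add_mul_le_pow (by norm_num) k
        _ = 1 := by rw [← mul_pow]; norm_num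
    have h5 := mul_le_mul_of_nonneg_left h4 hn0.le
    nlinarith [mul_le_mul_of_nonneg_right hpow (by positivity : (0 : ℝ) ≤ 1 + k * 3),
      (Nat.cast_nonneg k : (0 : ℝ) ≤ k)]
  set N : ℝ := (n : ℝ) - k with hN
  have hN0 : 0 < N := by linarith
  have hs : (m : ℝ) * (n - 2 * k) ≤ n * (N * p ^ k - m) := by
    nlinarith [mul_le_mul_of_nonneg_left hpow hN0.le]
  have hk0 : (0 : ℝ) ≤ k := Nat.cast_nonneg k
  have hs0 : 0 ≤ N * p ^ k - m :=
    nonneg_of_mul_nonneg_right ((by nlinarith : (0 : ℝ) ≤ m * (n - 2 * k)).trans hs) hn0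
  refine (erdosRenyi_not_isFace_le ⟨hp0.le, by linarith⟩ m f (by rw [hf]; linarith)).trans ?_
  rw [hf, ← hN]
  refine ENNReal.ofReal_le_ofReal (Real.exp_le_exp.2 ?_)
  rw [neg_div, neg_div, neg_le_neg_iff, div_le_div_iff₀ (by positivity) hN0]
  have hsq : ((m : ℝ) * (n - 2 * k)) ^ 2 ≤ (n * (N * p ^ k - m)) ^ 2 :=
    pow_le_pow_left₀ (by nlinarith) hs 2
  have hquad : (n : ℝ) * N ≤ 6 * (n - 2 * k) ^ 2 := by
    nlinarith [mul_nonneg (sub_nonneg.2 hkn) (by linarith : (0 : ℝ) ≤ 5 * n - 8 * k)]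
  refine le_of_mul_le_mul_left ?_ hn0
  calc (n : ℝ) * (m ^ 2 * N) = (m : ℝ) ^ 2 * (n * N) := by ring
    _ ≤ (m : ℝ) ^ 2 * (6 * (n - 2 * k) ^ 2) := by gcongr
    _ = 6 * ((m : ℝ) * (n - 2 * k)) ^ 2 := by ring
    _ ≤ 6 * (n * (N * p ^ k - m)) ^ 2 := by gcongr
    _ = n * (2 * (N * p ^ k - m) ^ 2 * (3 * n)) := by ring
end

section
/- Fix positive integers m and k and a real number b with b > k, and for each n let p_n = n^{−1/b}. Then the probability under G(n, p_n) that every k-element subset of [n] is a face of N_m(G) (i.e., has at least m common neighbors) tends to 1 as n → ∞. -/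
open MeasureTheory

lemma isProbabilityMeasure_bern_s11 {p : ℝ} (h0 : 0 ≤ p) (h1 : p ≤ 1) :
    IsProbabilityMeasure (bern p) := by
  constructor
  simp [bern, ← ENNReal.ofReal_add h0 (sub_nonneg.2 h1)]

lemma bern_true (p : ℝ) : bern p {true} = ENNReal.ofReal p := by
  simp [bern]

lemma isProbabilityMeasure_erdosRenyi (n : ℕ) {p : ℝ} (h0 : 0 ≤ p) (h1 : p ≤ 1) :
    IsProbabilityMeasure (erdosRenyi n p) := by
  have := isProbabilityMeasure_bern_s11 h0 h1
  unfold erdosRenyi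
  infer_instance

lemma erdosRenyi_forall_mem_eq_true (n : ℕ) {p : ℝ} (h0 : 0 ≤ p) (h1 : p ≤ 1)
    (E : Finset {e : Sym2 (Fin n) // ¬ e.IsDiag}) :
    erdosRenyi n p {ω | ∀ e ∈ E, ω e = true} = ENNReal.ofReal p ^ E.card := by
  classical
  have := isProbabilityMeasure_bern_s11 h0 h1
  have hset : {ω : EdgeCfg n | ∀ e ∈ E, ω e = true}
      = Set.univ.pi fun e => if e ∈ E then {true} else Set.univ := by
    ext ω
    simp only [Set.mem_ofPred_eq, Set.mem_pi, Set.mem_univ, true_implies]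
    refine forall_congr' fun e => ?_
    by_cases he : e ∈ E <;> simp [he]
  rw [hset, erdosRenyi, Measure.pi_pi]
  simp only [apply_ite (bern p), bern_true, measure_univ]
  simp

lemma erdosRenyi_forall_adj (n : ℕ) {p : ℝ} (h0 : 0 ≤ p) (h1 : p ≤ 1)
    (T S : Finset (Fin n)) (hTS : Disjoint T S) :
    erdosRenyi n p {ω | ∀ v ∈ T, ∀ u ∈ S, Adj ω v u}
      = ENNReal.ofReal p ^ (T.card * S.card) := by
  classical
  have hne : ∀ x : (T ×ˢ S : Finset (Fin n × Fin n)), x.1.1 ≠ x.1.2 := fun x =>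
    Finset.disjoint_iff_ne.1 hTS _ (Finset.mem_product.1 x.2).1 _ (Finset.mem_product.1 x.2).2
  let f : (T ×ˢ S : Finset (Fin n × Fin n)) → {e : Sym2 (Fin n) // ¬ e.IsDiag} := fun x =>
    ⟨s(x.1.1, x.1.2), by simpa [Sym2.mk_isDiag_iff] using hne x⟩
  have hf : Function.Injective f := by
    rintro ⟨⟨a, b⟩, hab⟩ ⟨⟨c, d⟩, hcd⟩ h
    simp only [f, Subtype.mk.injEq, Sym2.eq_iff] at h
    simp only [Finset.mem_product] at hab hcd
    rcases h with ⟨rfl, rfl⟩ | ⟨rfl, rfl⟩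
    · rfl
    · exact absurd rfl (Finset.disjoint_iff_ne.1 hTS _ hab.1 _ hcd.2)
  rw [← Finset.card_product, ← Fintype.card_coe (T ×ˢ S), ← Finset.card_univ,
    ← Finset.card_image_of_injective _ hf, ← erdosRenyi_forall_mem_eq_true n h0 h1]
  congr 1
  ext ω
  simp only [Set.mem_ofPred_eq, Finset.mem_image, Finset.mem_univ, true_and,
    forall_exists_index, forall_apply_eq_imp_iff]
  constructor
  · rintro h ⟨⟨a, b⟩, hab⟩
    obtain ⟨_, h⟩ := h a (Finset.mem_product.1 hab).1 b (Finset.mem_product.1 hab).2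
    exact h
  · intro h v hv u hu
    exact ⟨hne ⟨(v, u), Finset.mk_mem_product hv hu⟩, h ⟨(v, u), Finset.mk_mem_product hv hu⟩⟩

lemma erdosRenyi_forall_not_adj (n : ℕ) {p : ℝ} (h0 : 0 ≤ p) (h1 : p ≤ 1)
    (T S : Finset (Fin n)) (hTS : Disjoint T S) :
    erdosRenyi n p {ω | ∀ v ∈ T, ¬ ∀ u ∈ S, Adj ω v u}
      = ENNReal.ofReal (1 - p ^ S.card) ^ T.card := by
  classical
  have := isProbabilityMeasure_erdosRenyi n h0 h1
  let A : T → Set (EdgeCfg n) := fun v => {ω | ∀ u ∈ S, Adj ω v u}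
  have hA (v : T) : erdosRenyi n p (A v) = ENNReal.ofReal (p ^ S.card) := by
    have := erdosRenyi_forall_adj n h0 h1 {v.1} S
      (hTS.mono_left (Finset.singleton_subset_iff.2 v.2))
    simpa [ENNReal.ofReal_pow h0] using this
  have hind : ProbabilityTheory.iIndepSet A (erdosRenyi n p) := by
    rw [ProbabilityTheory.iIndepSet_iff_meas_biInter fun v => (Set.toFinite _).measurableSet]
    intro t
    have := erdosRenyi_forall_adj n h0 h1 (t.map (Function.Embedding.subtype _)) S
      (hTS.mono_left fun v hv => by
        obtain ⟨w, -, rfl⟩ := Finset.mem_map.1 hv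
        exact w.2)
    rw [Finset.prod_congr rfl fun v _ => hA v, Finset.prod_const, ENNReal.ofReal_pow h0, ← pow_mul,
      mul_comm, ← Finset.card_map (Function.Embedding.subtype _), ← this]
    congr 1
    ext ω
    simp [A]
  have hcompl := ProbabilityTheory.iIndep.meas_biInter hind (S := Finset.univ)
    (s := fun v => (A v)ᶜ)
    fun v _ => (MeasurableSpace.measurableSet_generateFrom (Set.mem_singleton _)).compl
  have hset : {ω : EdgeCfg n | ∀ v ∈ T, ¬ ∀ u ∈ S, Adj ω v u}
      = ⋂ v ∈ (Finset.univ : Finset T), (A v)ᶜ := by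
    ext ω
    simp [A]
  rw [hset, hcompl]
  simp_rw [prob_compl_eq_one_sub (Set.toFinite (A _)).measurableSet, hA]
  simp [ENNReal.ofReal_sub 1 (pow_nonneg h0 _)]

/-- The vertices outside `S` lying in the residue class of `j` modulo `m`. -/
def residueBlock {n : ℕ} (m j : ℕ) (S : Finset (Fin n)) : Finset (Fin n) :=
  (Finset.univ.filter fun v : Fin n => v.1 % m = j) \ S

lemma le_card_residueBlock {n m j : ℕ} (hj : j < m) (S : Finset (Fin n)) :
    n / m - S.card ≤ (residueBlock m j S).card := by
  refine le_trans (Nat.sub_le_sub_right ?_ _) (Finset.le_card_sdiff _ _)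
  have hlt : ∀ i : Fin (n / m), i.1 * m + j < n := fun i => by
    have h1 : (i.1 + 1) * m ≤ n / m * m := Nat.mul_le_mul_right _ i.2
    have h2 := Nat.div_mul_le_self n m
    linarith
  calc n / m = (Finset.univ : Finset (Fin (n / m))).card := by simp
    _ ≤ _ := by
      refine Finset.card_le_card_of_injOn (fun i => ⟨i.1 * m + j, hlt i⟩) ?_ ?_
      · intro i _
        simp [Nat.mod_eq_of_lt hj]
      · intro i _ i' _ h
        have : i.1 * m = i'.1 * m := by simpa using h
        exact Fin.ext (Nat.eq_of_mul_eq_mul_right (by omega) this)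

lemma isFace_of_residueBlock {n m : ℕ} (ω : EdgeCfg n) (S : Finset (Fin n))
    (h : ∀ j < m, ∃ v ∈ residueBlock m j S, ∀ u ∈ S, Adj ω v u) : IsFace ω m S := by
  rcases Nat.eq_zero_or_pos m with rfl | hm
  · exact Nat.zero_le _
  have : Nonempty (Fin n) := ⟨(h 0 hm).choose⟩
  choose! f hf hadj using h
  calc m = (Finset.range m).card := by simp
    _ ≤ _ := by
      refine Finset.card_le_card_of_injOn f ?_ ?_
      · intro j hj
        have hj := Finset.mem_range.1 hj
        have := Finset.mem_sdiff.1 (hf j hj)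
        simpa [commonNbrs] using ⟨this.2, hadj j hj⟩
      · intro i hi j hj hij
        have hi := hf i (Finset.mem_range.1 hi)
        have hj := hf j (Finset.mem_range.1 hj)
        simp only [residueBlock, Finset.mem_sdiff, Finset.mem_filter] at hi hj
        rw [← hi.1.2, ← hj.1.2, hij]

lemma erdosRenyi_not_forall_isFace_le (n m k : ℕ) {p : ℝ} (h0 : 0 ≤ p) (h1 : p ≤ 1) :
    erdosRenyi n p {ω | ∀ S : Finset (Fin n), S.card = k → IsFace ω m S}ᶜ
      ≤ ENNReal.ofReal (n ^ k * (m * (1 - p ^ k) ^ (n / m - k))) := by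
  have hq : 0 ≤ 1 - p ^ k := sub_nonneg.2 (pow_le_one₀ h0 h1)
  have hq1 : 1 - p ^ k ≤ 1 := sub_le_self _ (pow_nonneg h0 _)
  have hsub : {ω : EdgeCfg n | ∀ S : Finset (Fin n), S.card = k → IsFace ω m S}ᶜ
      ⊆ ⋃ S ∈ Finset.powersetCard k (Finset.univ : Finset (Fin n)), ⋃ j ∈ Finset.range m,
        {ω | ∀ v ∈ residueBlock m j S, ¬ ∀ u ∈ S, Adj ω v u} := by
    intro ω hω
    simp only [Set.mem_compl_iff, Set.mem_ofPred_eq, not_forall] at hω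
    obtain ⟨S, hS, hface⟩ := hω
    have := mt (isFace_of_residueBlock ω S) hface
    push Not at this
    obtain ⟨j, hj, h⟩ := this
    simp only [Set.mem_iUnion]
    refine ⟨S, by simp [hS], j, by simpa using hj, fun v hv hall => ?_⟩
    obtain ⟨u, hu, hn⟩ := h v hv
    exact hn (hall u hu)
  refine (measure_mono hsub).trans <| (measure_biUnion_finset_le _ _).trans ?_
  calc _ ≤ ∑ S ∈ Finset.powersetCard k (Finset.univ : Finset (Fin n)), ∑ j ∈ Finset.range m,
        ENNReal.ofReal ((1 - p ^ k) ^ (n / m - k)) := by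
        refine Finset.sum_le_sum fun S hS => (measure_biUnion_finset_le _ _).trans <|
          Finset.sum_le_sum fun j hj => ?_
        have hcard := (Finset.mem_powersetCard.1 hS).2
        rw [erdosRenyi_forall_not_adj n h0 h1 (residueBlock m j S) S Finset.sdiff_disjoint, hcard,
          ← ENNReal.ofReal_pow hq]
        refine ENNReal.ofReal_le_ofReal (pow_le_pow_of_le_one hq hq1 ?_)
        simpa only [hcard] using le_card_residueBlock (Finset.mem_range.1 hj) S
    _ ≤ _ := by
        simp only [Finset.sum_const, Finset.card_powersetCard, Finset.card_univ, Fintype.card_fin,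
          Finset.card_range, nsmul_eq_mul]
        rw [ENNReal.ofReal_mul (by positivity), ENNReal.ofReal_mul (by positivity),
          ENNReal.ofReal_natCast, ← Nat.cast_pow, ENNReal.ofReal_natCast]
        gcongr
        exact Nat.choose_le_pow n k

lemma tendsto_pow_mul_one_sub_rpow_pow (m k : ℕ) (hm : 0 < m) (b : ℝ) (hb : 0 < b)
    (hbk : (k : ℝ) < b) :
    Filter.Tendsto (fun n : ℕ =>
      (n : ℝ) ^ k * (m * (1 - ((n : ℝ) ^ (-(1 / b))) ^ k) ^ (n / m - k))) Filter.atTop (nhds 0) := by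
  have hm' : (0 : ℝ) < m := by exact_mod_cast hm
  set c : ℝ := 1 - k / b with hc
  have hc0 : 0 < c := sub_pos.2 ((div_lt_one hb).2 hbk)
  have hlim : Filter.Tendsto (fun n : ℕ =>
      (m : ℝ) * (((n : ℝ) ^ c) ^ (k / c) * Real.exp (-(1 / (2 * m)) * (n : ℝ) ^ c)))
      Filter.atTop (nhds 0) := by
    rw [← mul_zero (m : ℝ)]
    exact (((tendsto_rpow_mul_exp_neg_mul_atTop_nhds_zero (k / c) (1 / (2 * m)) (by positivity)).comp
      (tendsto_rpow_atTop hc0)).comp tendsto_natCast_atTop_atTop).const_mul _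
  refine tendsto_of_tendsto_of_tendsto_of_le_of_le' tendsto_const_nhds hlim ?_ ?_
  · filter_upwards [Filter.eventually_ge_atTop 1] with n hn
    have hn' : (1 : ℝ) ≤ n := by exact_mod_cast hn
    have h0 : 0 ≤ (n : ℝ) ^ (-(1 / b)) := by positivity
    have h1 : (n : ℝ) ^ (-(1 / b)) ≤ 1 :=
      Real.rpow_le_one_of_one_le_of_nonpos hn' (neg_nonpos.2 (by positivity))
    have := sub_nonneg.2 (pow_le_one₀ (n := k) h0 h1)
    positivity
  · filter_upwards [Filter.eventually_ge_atTop 1,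
      Filter.eventually_ge_atTop (2 * m * (k + 1))] with n hn hnk
    have hn' : (1 : ℝ) ≤ n := by exact_mod_cast hn
    have hn0 : (0 : ℝ) < n := by linarith
    have h0 : 0 ≤ (n : ℝ) ^ (-(1 / b)) := by positivity
    have h1 : (n : ℝ) ^ (-(1 / b)) ≤ 1 :=
      Real.rpow_le_one_of_one_le_of_nonpos hn' (neg_nonpos.2 (by positivity))
    have hq := sub_nonneg.2 (pow_le_one₀ (n := k) h0 h1)
    have hpk : ((n : ℝ) ^ (-(1 / b))) ^ k * n = (n : ℝ) ^ c := by
      rw [← Real.rpow_natCast, ← Real.rpow_mul hn0.le, ← Real.rpow_add_one hn0.ne']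
      congr 1
      rw [hc]
      ring
    have hexp : (n : ℝ) / (2 * m) ≤ (n / m - k : ℕ) := by
      have hd : (n : ℝ) / m < (n / m : ℕ) + 1 := by
        rw [div_lt_iff₀ hm']
        exact_mod_cast Nat.lt_mul_of_div_lt (Nat.lt_succ_self _) hm
      have hs : ((n / m : ℕ) : ℝ) ≤ (n / m - k : ℕ) + k := by exact_mod_cast le_tsub_add
      have hk : (k : ℝ) + 1 ≤ n / (2 * m) := by
        rw [le_div_iff₀ (by positivity)]
        have : (2 * m * (k + 1) : ℝ) ≤ n := by exact_mod_cast hnk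
        linarith
      have hh : (n : ℝ) / m = n / (2 * m) + n / (2 * m) := by field_simp; ring
      linarith
    have hpow : ((n : ℝ) ^ c) ^ (k / c) = (n : ℝ) ^ k := by
      rw [← Real.rpow_mul hn0.le, mul_div_cancel₀ _ hc0.ne', Real.rpow_natCast]
    rw [hpow, mul_left_comm]
    gcongr
    calc _ ≤ Real.exp (-((n : ℝ) ^ (-(1 / b))) ^ k) ^ (n / m - k) :=
          pow_le_pow_left₀ hq (Real.one_sub_le_exp_neg _) _
      _ = Real.exp (-(((n : ℝ) ^ (-(1 / b))) ^ k * (n / m - k : ℕ))) := by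
          rw [← Real.exp_nat_mul]
          congr 1
          ring
      _ ≤ _ := by
          rw [← hpk, Real.exp_le_exp, neg_mul, neg_le_neg_iff]
          calc _ = ((n : ℝ) ^ (-(1 / b))) ^ k * (n / (2 * m)) := by ring
            _ ≤ _ := by gcongr

/-- Lemma 4, upper direction: if $b > k$ and $p_n = n^{-1/b}$, the probability
that every $k$-set of vertices is a face of $N_m(G(n,p_n))$ tends to $1$. -/
theorem stmt11 (m k : ℕ) (hm : 0 < m) (hk : 0 < k) (b : ℝ) (hbk : (k : ℝ) < b) :
    Filter.Tendsto
      (fun n : ℕ => erdosRenyi n ((n : ℝ) ^ (-(1/b)))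
        {ω | ∀ S : Finset (Fin n), S.card = k → IsFace ω m S})
      Filter.atTop (nhds 1) := by
  have hb : 0 < b := (Nat.cast_nonneg k).trans_lt hbk
  have hbound : Filter.Tendsto (fun n : ℕ => 1 - ENNReal.ofReal
      ((n : ℝ) ^ k * (m * (1 - ((n : ℝ) ^ (-(1 / b))) ^ k) ^ (n / m - k))))
      Filter.atTop (nhds 1) := by
    have := ENNReal.Tendsto.sub (tendsto_const_nhds (x := (1 : ENNReal)) (f := Filter.atTop))
      (ENNReal.tendsto_ofReal (tendsto_pow_mul_one_sub_rpow_pow m k hm b hb hbk))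
      (Or.inl ENNReal.one_ne_top)
    simpa using this
  have hp : ∀ n : ℕ, 1 ≤ n → 0 ≤ (n : ℝ) ^ (-(1 / b)) ∧ (n : ℝ) ^ (-(1 / b)) ≤ 1 := fun n hn =>
    ⟨by positivity, Real.rpow_le_one_of_one_le_of_nonpos (by exact_mod_cast hn)
      (neg_nonpos.2 (by positivity))⟩
  refine tendsto_of_tendsto_of_tendsto_of_le_of_le' hbound tendsto_const_nhds ?_ ?_
  · filter_upwards [Filter.eventually_ge_atTop 1] with n hn
    obtain ⟨h0, h1⟩ := hp n hn
    have := isProbabilityMeasure_erdosRenyi n h0 h1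
    rw [tsub_le_iff_right, ← measure_univ (μ := erdosRenyi n ((n : ℝ) ^ (-(1 / b))))]
    refine (measure_univ_le_add_compl
      {ω | ∀ S : Finset (Fin n), S.card = k → IsFace ω m S}).trans ?_
    gcongr
    exact erdosRenyi_not_forall_isFace_le n m k h0 h1
  · filter_upwards [Filter.eventually_ge_atTop 1] with n hn
    obtain ⟨h0, h1⟩ := hp n hn
    have := isProbabilityMeasure_erdosRenyi n h0 h1
    exact prob_le_one
end
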